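/- Let g be a Lorentz metric, C₁ ∈ ℝ∖{0}, C₂ ∈ ℝ, ρ ∈ ℝ, and let A be a bivector. Define the medium tensor κ = C₁·∗_g + ρ(Ā⊗A) + C₂·Id on ℝ⁴. Then the zero set of the Fresnel polynomial of κ equals the null cone N(h) of some Lorentz metric h (i.e., κ is non-birefringent) if and only if A = 0 or ρ = 0. -/

import Mathlib

noncomputable section
open Matrix BigOperators

/-- Medium tensor components `κ^{ij}_{rs}` on ℝ⁴ (upper indices first). -/
abbrev MT := Fin 4 → Fin 4 → Fin 4 → Fin 4 → ℝ

/-- Bivector (or 2-form) components on ℝ⁴. -/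
abbrev BV := Fin 4 → Fin 4 → ℝ

/-- Totally antisymmetric Levi-Civita symbol on {0,1,2,3} with ε₀₁₂₃ = 1. -/
def eps (i j k l : Fin 4) : ℝ :=
  ((j.val : ℝ) - i.val) * ((k.val : ℝ) - i.val) * ((l.val : ℝ) - i.val) *
    ((k.val : ℝ) - j.val) * ((l.val : ℝ) - j.val) * ((l.val : ℝ) - k.val) / 12

/-- Identity medium tensor `Id^{ij}_{rs} = δ^i_r δ^j_s − δ^i_s δ^j_r`. -/
def idT : MT := fun i j r s =>
  (if i = r then (1 : ℝ) else 0) * (if j = s then 1 else 0) -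
    (if i = s then 1 else 0) * (if j = r then 1 else 0)

/-- Composition `(κ∘η)^{ij}_{rs} = (1/2) κ^{ab}_{rs} η^{ij}_{ab}`. -/
def compT (κ η : MT) : MT := fun i j r s => (1 / 2) * ∑ a, ∑ b, κ a b r s * η i j a b

/-- Poincaré adjoint `κ̄^{ij}_{rs} = (1/4) ε_{rsab} κ^{ab}_{cd} ε^{cdij}`. -/
def adjT (κ : MT) : MT := fun i j r s =>
  (1 / 4) * ∑ a, ∑ b, ∑ c, ∑ d, eps r s a b * κ a b c d * eps c d i j

/-- Trace `tr κ = (1/2) κ^{ij}_{ij}`. -/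
def traceT (κ : MT) : ℝ := (1 / 2) * ∑ i, ∑ j, κ i j i j

def antisymBV (A : BV) : Prop := ∀ i j, A i j = - A j i

def antisymMT (κ : MT) : Prop :=
  (∀ i j r s, κ i j r s = - κ j i r s) ∧ (∀ i j r s, κ i j r s = - κ i j s r)

/-- The medium tensor `(ρ Ā⊗B)^{ij}_{rs} = ρ ε_{rsab} A^{ab} B^{ij}`. -/
def tensAB (ρ : ℝ) (A B : BV) : MT := fun i j r s =>
  ρ * (∑ a, ∑ b, eps r s a b * A a b) * B i j

/-- Hodge star `(∗_g)^{ij}_{rs} = √|det g| g^{ia} g^{jb} ε_{abrs}`. -/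
def hodge (g : Matrix (Fin 4) (Fin 4) ℝ) : MT := fun i j r s =>
  Real.sqrt |g.det| * ∑ a, ∑ b, g⁻¹ i a * g⁻¹ j b * eps a b r s

/-- The (non-symmetrised) Fresnel tensor density `𝒢₀^{ijkl}`. -/
def G0 (κ : MT) (i j k l : Fin 4) : ℝ :=
  (1 / 48) * ∑ a₁, ∑ a₂, ∑ a₃, ∑ a₄, ∑ b₁, ∑ b₂, ∑ b₃, ∑ b₄, ∑ b₅, ∑ b₆,
    κ a₁ a₂ b₁ b₂ * κ a₃ i b₃ b₄ * κ a₄ j b₅ b₆ *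
      eps b₁ b₂ b₅ k * eps b₃ b₄ b₆ l * eps a₁ a₂ a₃ a₄

/-- Fresnel polynomial `G(ξ) = 𝒢₀^{ijkl} ξ_i ξ_j ξ_k ξ_l`. -/
def fresnel (κ : MT) (ξ : Fin 4 → ℝ) : ℝ :=
  ∑ i, ∑ j, ∑ k, ∑ l, G0 κ i j k l * ξ i * ξ j * ξ k * ξ l

/-- A Lorentz metric: real symmetric invertible 4×4 matrix of signature
(−+++) or (+−−−), equivalently symmetric with negative determinant. -/
def IsLorentz (g : Matrix (Fin 4) (Fin 4) ℝ) : Prop := g.IsSymm ∧ g.det < 0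

/-- Null cone `N(g) = {ξ : g^{ij} ξ_i ξ_j = 0}` (on covectors, via the inverse metric). -/
def nullCone (g : Matrix (Fin 4) (Fin 4) ℝ) : Set (Fin 4 → ℝ) :=
  {ξ | ∑ i, ∑ j, g⁻¹ i j * ξ i * ξ j = 0}

/-- The ordering O = (01, 02, 03, 23, 31, 12) of index pairs. -/
def pairs : Fin 6 → Fin 4 × Fin 4 := ![(0, 1), (0, 2), (0, 3), (2, 3), (3, 1), (1, 2)]

/-- The 6×6 matrix representing a medium tensor: `M_{IJ} = κ^{J₁J₂}_{I₁I₂}`. -/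
def mat6 (κ : MT) : Matrix (Fin 6) (Fin 6) ℝ := fun I J =>
  κ (pairs J).1 (pairs J).2 (pairs I).1 (pairs I).2

/-- The Fresnel surface decomposes into a double light cone. -/
def DoubleCone (κ : MT) : Prop :=
  ∃ gp gm, IsLorentz gp ∧ IsLorentz gm ∧ nullCone gp ≠ nullCone gm ∧
    {ξ | fresnel κ ξ = 0} = nullCone gp ∪ nullCone gm

/-- `ε^{abck} ξ_k` as a matrix from index pairs to indices. -/
def epsCov (ξ : Fin 4 → ℝ) : Matrix (Fin 4 × Fin 4) (Fin 4) ℝ :=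
  fun p c => ∑ k, eps p.1 p.2 c k * ξ k

/-- A medium tensor as a matrix on index pairs. -/
def pairMat (κ : MT) : Matrix (Fin 4 × Fin 4) (Fin 4 × Fin 4) ℝ :=
  fun p q => κ p.1 p.2 q.1 q.2

/-- Contraction with a covector in the second slot of an index pair. -/
def sndCov (ξ : Fin 4 → ℝ) : Matrix (Fin 4) (Fin 4 × Fin 4) ℝ :=
  fun a p => if a = p.1 then ξ p.2 else 0

/-- The Levi-Civita symbol as a matrix from index triples to indices. -/
def epsMat : Matrix ((Fin 4 × Fin 4) × Fin 4) (Fin 4) ℝ :=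
  fun p d => eps p.1.1 p.1.2 p.2 d

open scoped Kronecker

theorem sndCov_mul {n : Type*} (ξ : Fin 4 → ℝ)
    (B : Matrix (Fin 4 × Fin 4) n ℝ) (a : Fin 4) (x : n) :
    (sndCov ξ * B) a x = ∑ i, ξ i * B (a, i) x := by
  simp [Matrix.mul_apply, sndCov, Fintype.sum_prod_type, ite_mul]

theorem sum_reorder (f : Fin 4 → Fin 4 → Fin 4 → Fin 4 → Fin 4 → Fin 4 → Fin 4 → Fin 4 →
      Fin 4 → Fin 4 → Fin 4 → Fin 4 → Fin 4 → Fin 4 → ℝ) :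
    ∑ i, ∑ j, ∑ k, ∑ l, ∑ a₁, ∑ a₂, ∑ a₃, ∑ a₄, ∑ b₁, ∑ b₂, ∑ b₃, ∑ b₄, ∑ b₅, ∑ b₆,
      f i j k l a₁ a₂ a₃ a₄ b₁ b₂ b₃ b₄ b₅ b₆ =
    ∑ a₄, ∑ a₁, ∑ a₂, ∑ a₃, ∑ b₅, ∑ b₆, ∑ j, ∑ i, ∑ b₃, ∑ b₄, ∑ l, ∑ b₁, ∑ b₂, ∑ k,
      f i j k l a₁ a₂ a₃ a₄ b₁ b₂ b₃ b₄ b₅ b₆ := by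
  iterate 13 rw [← Fintype.sum_prod_type']
  symm
  iterate 13 rw [← Fintype.sum_prod_type']
  symm
  exact Fintype.sum_bijective
    (fun ⟨⟨⟨⟨⟨⟨⟨⟨⟨⟨⟨⟨⟨i, j⟩, k⟩, l⟩, a₁⟩, a₂⟩, a₃⟩, a₄⟩, b₁⟩, b₂⟩, b₃⟩, b₄⟩, b₅⟩, b₆⟩ =>
      ⟨⟨⟨⟨⟨⟨⟨⟨⟨⟨⟨⟨⟨a₄, a₁⟩, a₂⟩, a₃⟩, b₅⟩, b₆⟩, j⟩, i⟩, b₃⟩, b₄⟩, l⟩, b₁⟩, b₂⟩, k⟩)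
    (Function.bijective_iff_has_inverse.2
      ⟨fun ⟨⟨⟨⟨⟨⟨⟨⟨⟨⟨⟨⟨⟨a₄, a₁⟩, a₂⟩, a₃⟩, b₅⟩, b₆⟩, j⟩, i⟩, b₃⟩, b₄⟩, l⟩, b₁⟩, b₂⟩, k⟩ =>
        ⟨⟨⟨⟨⟨⟨⟨⟨⟨⟨⟨⟨⟨i, j⟩, k⟩, l⟩, a₁⟩, a₂⟩, a₃⟩, a₄⟩, b₁⟩, b₂⟩, b₃⟩, b₄⟩, b₅⟩, b₆⟩,
        fun _ => rfl, fun _ => rfl⟩)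
    _ _ (fun _ => rfl)

/-- The last contraction in the Fresnel polynomial. -/
def fresnelContr (S : Matrix (Fin 4 × Fin 4) (Fin 4) ℝ) (R : Matrix (Fin 4) (Fin 4) ℝ)
    (P : Matrix (Fin 4) (Fin 4 × Fin 4) ℝ) : ℝ :=
  Matrix.trace (epsMatᵀ * ((S ⊗ₖ R) * Pᵀ))

theorem fresnelContr_eq (S : Matrix (Fin 4 × Fin 4) (Fin 4) ℝ) (R : Matrix (Fin 4) (Fin 4) ℝ)
    (P : Matrix (Fin 4) (Fin 4 × Fin 4) ℝ) :
    fresnelContr S R P = ∑ a₄, ∑ a₁, ∑ a₂, ∑ a₃, eps a₁ a₂ a₃ a₄ *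
      ∑ b₅, ∑ b₆, S (a₁, a₂) b₅ * R a₃ b₆ * P a₄ (b₅, b₆) := by
  simp only [fresnelContr, Matrix.trace, Matrix.diag, Matrix.mul_apply, Matrix.transpose_apply,
    Matrix.kroneckerMap_apply, Fintype.sum_prod_type, epsMat]

theorem fresnel_eq (κ : MT) (ξ : Fin 4 → ℝ) :
    fresnel κ ξ = (1 / 48) * fresnelContr (pairMat κ * epsCov ξ)
      (sndCov ξ * (pairMat κ * epsCov ξ)) (sndCov ξ * pairMat κ) := by
  have hG : ∀ i j k l, G0 κ i j k l * ξ i * ξ j * ξ k * ξ l =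
      ∑ a₁, ∑ a₂, ∑ a₃, ∑ a₄, ∑ b₁, ∑ b₂, ∑ b₃, ∑ b₄, ∑ b₅, ∑ b₆,
        κ a₁ a₂ b₁ b₂ * κ a₃ i b₃ b₄ * κ a₄ j b₅ b₆ *
          eps b₁ b₂ b₅ k * eps b₃ b₄ b₆ l * eps a₁ a₂ a₃ a₄ *
            (1 / 48 * ξ i * ξ j * ξ k * ξ l) := by
    intro i j k l
    rw [G0, mul_assoc, mul_assoc, mul_assoc, mul_comm (1 / 48 : ℝ), mul_assoc,
      show (1 / 48 : ℝ) * (ξ i * (ξ j * (ξ k * ξ l))) = 1 / 48 * ξ i * ξ j * ξ k * ξ l by ring]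
    iterate 9
      rw [Finset.sum_mul]
      refine Finset.sum_congr rfl fun _ _ => ?_
    rw [Finset.sum_mul]
  rw [fresnelContr_eq, fresnel]
  refine (Finset.sum_congr rfl fun i _ => Finset.sum_congr rfl fun j _ =>
    Finset.sum_congr rfl fun k _ => Finset.sum_congr rfl fun l _ => hG i j k l).trans ?_
  rw [sum_reorder, Finset.mul_sum]
  refine Finset.sum_congr rfl fun a₄ _ => ?_
  rw [Finset.mul_sum]
  refine Finset.sum_congr rfl fun a₁ _ => ?_
  rw [Finset.mul_sum]
  refine Finset.sum_congr rfl fun a₂ _ => ?_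
  rw [Finset.mul_sum]
  refine Finset.sum_congr rfl fun a₃ _ => ?_
  rw [Finset.mul_sum, Finset.mul_sum]
  refine Finset.sum_congr rfl fun b₅ _ => ?_
  rw [Finset.mul_sum, Finset.mul_sum]
  refine Finset.sum_congr rfl fun b₆ _ => ?_
  simp only [sndCov_mul]
  simp only [Matrix.mul_apply, Fintype.sum_prod_type, pairMat, epsCov, Finset.mul_sum,
    Finset.sum_mul]
  iterate 8 refine Finset.sum_congr rfl fun _ _ => ?_
  ring

theorem det_eq_sum_eps (N : Matrix (Fin 4) (Fin 4) ℝ) :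
    N.det = ∑ a, ∑ b, ∑ c, ∑ d, eps a b c d * N 0 a * N 1 b * N 2 c * N 3 d := by
  simp [Matrix.det_succ_row_zero, Fin.sum_univ_succ, eps, Fin.succAbove]
  norm_num
  ring

theorem sum_eps_mul (M : Matrix (Fin 4) (Fin 4) ℝ) (i j k l : Fin 4) :
    ∑ a, ∑ b, ∑ c, ∑ d, eps a b c d * M i a * M j b * M k c * M l d = M.det * eps i j k l := by
  have h := det_eq_sum_eps (M.submatrix ![i, j, k, l] id)
  simp only [Matrix.submatrix_apply, id, Matrix.cons_val] at h
  rw [← h]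
  have h2 : M.submatrix ![i, j, k, l] id =
    (1 : Matrix (Fin 4) (Fin 4) ℝ).submatrix ![i, j, k, l] id * M := by
    ext x y
    simp only [Matrix.mul_apply, Matrix.submatrix_apply, Matrix.one_apply, id]
    simp
  rw [h2, Matrix.det_mul, mul_comm]
  congr 1
  rw [det_eq_sum_eps]
  have h1 : ∀ (F : Fin 4 → ℝ) (x : Fin 4),
      ∑ a, F a * (1 : Matrix (Fin 4) (Fin 4) ℝ) x a = F x := by
    simp [Matrix.one_apply]
  change ∑ a, ∑ b, ∑ c, ∑ d, eps a b c d * (1 : Matrix (Fin 4) (Fin 4) ℝ) i a *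
    (1 : Matrix (Fin 4) (Fin 4) ℝ) j b * (1 : Matrix (Fin 4) (Fin 4) ℝ) k c *
    (1 : Matrix (Fin 4) (Fin 4) ℝ) l d = _
  simp only [h1]

/-- Cofactor-type transformation of the Levi-Civita symbol with a covector in the last slot. -/
theorem kron_mul_epsCov (M N : Matrix (Fin 4) (Fin 4) ℝ) (hMN : M * N = 1) (ξ : Fin 4 → ℝ) :
    (N ⊗ₖ N) * epsCov ξ = N.det • (epsCov (Mᵀ *ᵥ ξ) * Mᵀ) := by
  have hNM : N * M = 1 := mul_eq_one_comm.1 hMN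
  have hξ : ξ = Nᵀ *ᵥ (Mᵀ *ᵥ ξ) := by
    rw [Matrix.mulVec_mulVec, ← Matrix.transpose_mul, hMN, Matrix.transpose_one,
      Matrix.one_mulVec]
  have key : ∀ ζ : Fin 4 → ℝ, (N ⊗ₖ N) * epsCov (Nᵀ *ᵥ ζ) * Nᵀ = N.det • epsCov ζ := by
    intro ζ
    ext ⟨i, j⟩ k
    simp only [Matrix.mul_apply, Matrix.kroneckerMap_apply, Fintype.sum_prod_type, epsCov,
      Matrix.smul_apply, smul_eq_mul, Finset.mul_sum, ← mul_assoc, ← sum_eps_mul]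
    simp only [Matrix.mulVec, dotProduct, Finset.sum_mul, Finset.mul_sum, Matrix.transpose_apply]
    rw [Finset.sum_comm]
    symm
    rw [Finset.sum_comm]
    refine Finset.sum_congr rfl fun a _ => ?_
    rw [Finset.sum_comm]
    symm
    rw [Finset.sum_comm]
    refine Finset.sum_congr rfl fun b _ => ?_
    symm
    rw [Finset.sum_comm]
    refine Finset.sum_congr rfl fun c _ => ?_
    rw [Finset.sum_comm]
    refine Finset.sum_congr rfl fun d _ => Finset.sum_congr rfl fun m _ => ?_
    ring
  have h := key (Mᵀ *ᵥ ξ)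
  rw [← hξ] at h
  rw [← Matrix.smul_mul, ← h, Matrix.mul_assoc _ Nᵀ, ← Matrix.transpose_mul, hMN,
    Matrix.transpose_one, Matrix.mul_one]

theorem kron_transpose_mul_epsMat (M : Matrix (Fin 4) (Fin 4) ℝ) :
    ((M ⊗ₖ M) ⊗ₖ M)ᵀ * epsMat * M = M.det • epsMat := by
  ext ⟨⟨i, j⟩, k⟩ l
  simp only [Matrix.mul_apply, Matrix.kroneckerMap_apply, Fintype.sum_prod_type, epsMat,
      Matrix.smul_apply, smul_eq_mul, Matrix.transpose_apply]
  rw [← Matrix.det_transpose, ← sum_eps_mul]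
  simp only [Finset.sum_mul, Matrix.transpose_apply]
  rw [Finset.sum_comm]
  refine Finset.sum_congr rfl fun a _ => ?_
  rw [Finset.sum_comm]
  refine Finset.sum_congr rfl fun b _ => ?_
  rw [Finset.sum_comm]
  refine Finset.sum_congr rfl fun c _ => Finset.sum_congr rfl fun d _ => ?_
  ring

theorem sndCov_mul_kron (M : Matrix (Fin 4) (Fin 4) ℝ) (ξ : Fin 4 → ℝ) :
    sndCov ξ * (M ⊗ₖ M) = M * sndCov (Mᵀ *ᵥ ξ) := by
  ext a ⟨i, j⟩
  rw [sndCov_mul]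
  simp only [Matrix.mul_apply, Matrix.kroneckerMap_apply, sndCov, Matrix.mulVec, dotProduct,
    Matrix.transpose_apply, mul_ite, mul_zero, Finset.sum_ite_eq', Finset.mem_univ, if_true,
    Finset.mul_sum]
  exact Finset.sum_congr rfl fun _ _ => by ring

/-- The Fresnel polynomial is a density-valued covariant of the medium tensor. -/
theorem fresnel_covariant (M N : Matrix (Fin 4) (Fin 4) ℝ) (hMN : M * N = 1) (κ κ' : MT)
    (h : pairMat κ = (M ⊗ₖ M) * pairMat κ' * (N ⊗ₖ N)) (ξ : Fin 4 → ℝ) :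
    fresnel κ ξ = N.det * fresnel κ' (Mᵀ *ᵥ ξ) := by
  have hNM : N * M = 1 := mul_eq_one_comm.1 hMN
  have hdet : M.det * N.det = 1 := by rw [← Matrix.det_mul, hMN, Matrix.det_one]
  set ζ := Mᵀ *ᵥ ξ
  have hS : pairMat κ * epsCov ξ = N.det • ((M ⊗ₖ M) * (pairMat κ' * epsCov ζ) * Mᵀ) := by
    rw [h, Matrix.mul_assoc, kron_mul_epsCov M N hMN]
    simp only [Matrix.mul_smul, Matrix.mul_assoc, ζ]
  have hR : sndCov ξ * (pairMat κ * epsCov ξ) =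
      N.det • (M * (sndCov ζ * (pairMat κ' * epsCov ζ)) * Mᵀ) := by
    rw [hS, Matrix.mul_smul, ← Matrix.mul_assoc, ← Matrix.mul_assoc, sndCov_mul_kron]
    simp only [Matrix.mul_assoc, ζ]
  have hP : sndCov ξ * pairMat κ = M * (sndCov ζ * pairMat κ') * (N ⊗ₖ N) := by
    rw [h, ← Matrix.mul_assoc, ← Matrix.mul_assoc, sndCov_mul_kron]
    simp only [Matrix.mul_assoc, ζ]
  rw [fresnel_eq, fresnel_eq κ', hR, hS, hP]
  generalize pairMat κ' * epsCov ζ = S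
  generalize sndCov ζ * S = R
  generalize sndCov ζ * pairMat κ' = P
  have hNNMM : (Mᵀ ⊗ₖ Mᵀ) * (N ⊗ₖ N)ᵀ = 1 := by
    rw [Matrix.kroneckerMap_transpose, ← Matrix.transpose_mul, ← Matrix.mul_kronecker_mul, hNM,
      Matrix.one_kronecker_one, Matrix.transpose_one]
  have hX : ((N.det • ((M ⊗ₖ M) * S * Mᵀ)) ⊗ₖ (N.det • (M * R * Mᵀ))) *
      (M * P * (N ⊗ₖ N))ᵀ =
      (N.det * N.det) • (((M ⊗ₖ M) ⊗ₖ M) * ((S ⊗ₖ R) * Pᵀ) * Mᵀ) := by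
    rw [Matrix.smul_kronecker, Matrix.kronecker_smul, smul_smul, Matrix.smul_mul,
      Matrix.mul_kronecker_mul, Matrix.mul_kronecker_mul, Matrix.transpose_mul,
      Matrix.transpose_mul, Matrix.mul_assoc _ (Mᵀ ⊗ₖ Mᵀ), ← Matrix.mul_assoc (Mᵀ ⊗ₖ Mᵀ),
      hNNMM, Matrix.one_mul]
    simp only [Matrix.mul_assoc]
  have hE := kron_transpose_mul_epsMat M
  have hE' : Mᵀ * epsMatᵀ * ((M ⊗ₖ M) ⊗ₖ M) = M.det • epsMatᵀ := by
    rw [← Matrix.transpose_smul, ← hE, Matrix.transpose_mul, Matrix.transpose_mul,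
      Matrix.transpose_transpose, Matrix.mul_assoc]
  rw [fresnelContr, fresnelContr, hX, Matrix.mul_smul, Matrix.trace_smul, ← Matrix.mul_assoc,
    Matrix.trace_mul_comm, ← Matrix.mul_assoc, ← Matrix.mul_assoc, hE', Matrix.smul_mul,
    Matrix.trace_smul, smul_eq_mul, smul_eq_mul]
  linear_combination (1 / 48 * N.det * Matrix.trace (epsMatᵀ * ((S ⊗ₖ R) * Pᵀ))) * hdet

/-- The diagonal of the Minkowski metric. -/
def minkDiag : Fin 4 → ℝ := ![-1, 1, 1, 1]

/-- A medium tensor of generalized Q-type in a Minkowski frame. -/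
def minkMedium (p ρ C : ℝ) (A : BV) : MT := fun i j r s =>
  p * (minkDiag i * minkDiag j * eps i j r s) + tensAB ρ A A i j r s + C * idT i j r s

/-- Integer-valued Levi-Civita symbol. -/
def epsInt (i j k l : Fin 4) : ℤ :=
  ((j.val : ℤ) - i.val) * ((k.val : ℤ) - i.val) * ((l.val : ℤ) - i.val) *
    ((k.val : ℤ) - j.val) * ((l.val : ℤ) - j.val) * ((l.val : ℤ) - k.val) / 12

theorem eps_eq_epsInt (i j k l : Fin 4) : eps i j k l = epsInt i j k l := by
  have h : ∀ i j k l : Fin 4, 12 * epsInt i j k l =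
    ((j.val : ℤ) - i.val) * ((k.val : ℤ) - i.val) * ((l.val : ℤ) - i.val) *
      ((k.val : ℤ) - j.val) * ((l.val : ℤ) - j.val) * ((l.val : ℤ) - k.val) := by
    decide +kernel
  have h2 := congrArg (Int.cast : ℤ → ℝ) (h i j k l)
  push_cast at h2
  rw [eps]
  linarith

theorem sum_eps_mul_eps (a b c k : Fin 4) :
    ∑ r, ∑ s, eps a b r s * eps r s c k = 2 * idT a b c k := by
  have h : ∀ a b c k : Fin 4, ∑ r, ∑ s, epsInt a b r s * epsInt r s c k =
      2 * ((if a = c then 1 else 0) * (if b = k then 1 else 0) -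
        (if a = k then 1 else 0) * (if b = c then 1 else 0)) := by
    decide +kernel
  have h2 := congrArg (Int.cast : ℤ → ℝ) (h a b c k)
  push_cast at h2
  simp only [eps_eq_epsInt, idT, h2]

theorem sum_idT_mul (a b : Fin 4) (F : Fin 4 → Fin 4 → ℝ) :
    ∑ c, ∑ d, idT a b c d * F c d = F a b - F b a := by
  simp [idT, sub_mul, Finset.sum_sub_distrib]

theorem sum_mul_idT (a b : Fin 4) (F : Fin 4 → Fin 4 → ℝ) :
    ∑ c, ∑ d, F c d * idT c d a b = F a b - F b a := by
  simp [idT, mul_sub, Finset.sum_sub_distrib]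

theorem eps_swap_pairs (a b c d : Fin 4) : eps c d a b = eps a b c d := by
  simp only [eps]; ring

theorem eps_swap_left (a b c d : Fin 4) : eps b a c d = - eps a b c d := by
  simp only [eps]; ring

theorem sum_sum_comm_pairs (f : Fin 4 → Fin 4 → Fin 4 → Fin 4 → ℝ) :
    ∑ r, ∑ s, ∑ x, ∑ y, f r s x y = ∑ x, ∑ y, ∑ r, ∑ s, f r s x y := by
  calc _ = ∑ r, ∑ x, ∑ s, ∑ y, f r s x y := Finset.sum_congr rfl fun _ _ => Finset.sum_comm
    _ = ∑ x, ∑ r, ∑ s, ∑ y, f r s x y := Finset.sum_comm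
    _ = ∑ x, ∑ r, ∑ y, ∑ s, f r s x y :=
      Finset.sum_congr rfl fun _ _ => Finset.sum_congr rfl fun _ _ => Finset.sum_comm
    _ = _ := Finset.sum_congr rfl fun _ _ => Finset.sum_comm

theorem sum_dual_mul_eps (A : BV) (hA : antisymBV A) (c k : Fin 4) :
    ∑ r, ∑ s, (∑ x, ∑ y, eps r s x y * A x y) * eps r s c k = 4 * A c k := by
  calc _ = ∑ x, ∑ y, A x y * ∑ r, ∑ s, eps x y r s * eps r s c k := by
        simp only [Finset.mul_sum, Finset.sum_mul]
        rw [sum_sum_comm_pairs]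
        refine Finset.sum_congr rfl fun x _ => Finset.sum_congr rfl fun y _ =>
          Finset.sum_congr rfl fun r _ => Finset.sum_congr rfl fun s _ => ?_
        rw [eps_swap_pairs x y r s]
        ring
    _ = 2 * (∑ x, ∑ y, A x y * idT x y c k) := by
        simp only [sum_eps_mul_eps, Finset.mul_sum]
        simp only [mul_left_comm]
    _ = _ := by rw [sum_mul_idT, hA k c]; ring

theorem minkMedium_mul_epsCov (p ρ C : ℝ) (A : BV) (hA : antisymBV A) (ξ : Fin 4 → ℝ)
    (a b c : Fin 4) :
    (pairMat (minkMedium p ρ C A) * epsCov ξ) (a, b) c =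
      2 * p * minkDiag a * minkDiag b *
        ((if a = c then ξ b else 0) - (if b = c then ξ a else 0)) +
      4 * ρ * A a b * (∑ k, A c k * ξ k) + 2 * C * ∑ k, eps a b c k * ξ k := by
  have hsplit : ∀ (k : Fin 4) (T : Fin 4 → Fin 4 → ℝ), ∑ r, ∑ s,
      (p * (minkDiag a * minkDiag b * eps a b r s) + ρ * T r s * A a b + C * idT a b r s) *
        eps r s c k = p * minkDiag a * minkDiag b * ∑ r, ∑ s, eps a b r s * eps r s c k +
      ρ * A a b * (∑ r, ∑ s, T r s * eps r s c k) +
        C * (∑ r, ∑ s, idT a b r s * eps r s c k) := by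
    intro k T
    simp only [Finset.mul_sum, ← Finset.sum_add_distrib]
    exact Finset.sum_congr rfl fun _ _ => Finset.sum_congr rfl fun _ _ => by ring
  have hk : ∀ k, ∑ r, ∑ s, minkMedium p ρ C A a b r s * eps r s c k =
      2 * p * minkDiag a * minkDiag b * idT a b c k + 4 * ρ * A a b * A c k +
        2 * C * eps a b c k := by
    intro k
    calc _ = p * minkDiag a * minkDiag b * ∑ r, ∑ s, eps a b r s * eps r s c k +
          ρ * A a b * (∑ r, ∑ s, (∑ x, ∑ y, eps r s x y * A x y) * eps r s c k) +
          C * (∑ r, ∑ s, idT a b r s * eps r s c k) := by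
          simp only [minkMedium, tensAB]
          exact hsplit k _
      _ = _ := by
          rw [sum_eps_mul_eps, sum_dual_mul_eps A hA, sum_idT_mul, eps_swap_left a b c k]
          ring
  calc _ = ∑ k, (∑ r, ∑ s, minkMedium p ρ C A a b r s * eps r s c k) * ξ k := by
        simp only [Matrix.mul_apply, Fintype.sum_prod_type, pairMat, epsCov, Finset.mul_sum,
          Finset.sum_mul]
        symm
        rw [Finset.sum_comm]
        refine Finset.sum_congr rfl fun r _ => ?_
        rw [Finset.sum_comm]
        refine Finset.sum_congr rfl fun s _ => Finset.sum_congr rfl fun k _ => ?_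
        ring
    _ = _ := by
        have h : (if a = c then ξ b else 0) - (if b = c then ξ a else 0) =
            ∑ k, idT a b c k * ξ k := by
          simp [idT, sub_mul, Finset.sum_sub_distrib]
        rw [h]
        simp only [hk, Finset.mul_sum, ← Finset.sum_add_distrib]
        exact Finset.sum_congr rfl fun _ _ => by ring

theorem sndCov_mul_minkMedium (p ρ C : ℝ) (A : BV) (ξ : Fin 4 → ℝ) (a r s : Fin 4) :
    (sndCov ξ * pairMat (minkMedium p ρ C A)) a (r, s) =
      p * minkDiag a * (∑ i, eps a i r s * (minkDiag i * ξ i)) +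
      ρ * (∑ x, ∑ y, eps r s x y * A x y) * (∑ i, A a i * ξ i) +
      C * ((if a = r then ξ s else 0) - (if a = s then ξ r else 0)) := by
  rw [sndCov_mul]
  simp only [pairMat, minkMedium, tensAB]
  generalize (∑ x, ∑ y, eps r s x y * A x y) = T
  have h : (if a = r then ξ s else 0) - (if a = s then ξ r else 0) = ∑ i, idT a i r s * ξ i := by
    simp [idT, sub_mul, Finset.sum_sub_distrib]
  rw [h]
  simp only [Finset.mul_sum, ← Finset.sum_add_distrib]
  exact Finset.sum_congr rfl fun _ _ => by ring

theorem sndCov_mul_minkMedium_mul_epsCov (p ρ C : ℝ) (A : BV) (hA : antisymBV A)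
    (ξ : Fin 4 → ℝ) (a c : Fin 4) :
    (sndCov ξ * (pairMat (minkMedium p ρ C A) * epsCov ξ)) a c =
      2 * p * minkDiag a * ((if a = c then ∑ i, minkDiag i * ξ i * ξ i else 0) -
        minkDiag c * ξ c * ξ a) +
      4 * ρ * (∑ k, A a k * ξ k) * (∑ k, A c k * ξ k) := by
  rw [sndCov_mul]
  simp only [minkMedium_mul_epsCov p ρ C A hA]
  fin_cases a <;> fin_cases c <;>
    simp [Fin.sum_univ_four, eps, minkDiag] <;> ring

theorem sum_eps_mul_of_antisymm (F : Fin 4 → Fin 4 → Fin 4 → Fin 4 → ℝ)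
    (hF : ∀ a b c d, F b a c d = -F a b c d) :
    ∑ d, ∑ a, ∑ b, ∑ c, eps a b c d * F a b c d =
     2 * (F 0 1 2 3 - F 0 1 3 2 + F 0 2 3 1 - F 0 2 1 3 + F 0 3 1 2 - F 0 3 2 1 +
      F 1 2 0 3 - F 1 2 3 0 + F 1 3 2 0 - F 1 3 0 2 + F 2 3 0 1 - F 2 3 1 0) := by
  simp [Fin.sum_univ_four, eps]
  norm_num
  rw [hF 0 1, hF 0 1, hF 0 2, hF 0 2, hF 0 3, hF 0 3, hF 1 2, hF 1 2, hF 1 3, hF 1 3, hF 2 3, hF 2 3]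
  ring

theorem fresnelContr_eq_of_antisymm (S : Matrix (Fin 4 × Fin 4) (Fin 4) ℝ)
    (R : Matrix (Fin 4) (Fin 4) ℝ) (P : Matrix (Fin 4) (Fin 4 × Fin 4) ℝ)
    (hS : ∀ a b c, S (b, a) c = - S (a, b) c) :
    fresnelContr S R P = 2 * ∑ f,
      (R 0 f * ∑ e, (S (1, 2) e * P 3 (e, f) - S (1, 3) e * P 2 (e, f) + S (2, 3) e * P 1 (e, f)) -
       R 1 f * ∑ e, (S (0, 2) e * P 3 (e, f) - S (0, 3) e * P 2 (e, f) + S (2, 3) e * P 0 (e, f)) +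
       R 2 f * ∑ e, (S (0, 1) e * P 3 (e, f) - S (0, 3) e * P 1 (e, f) + S (1, 3) e * P 0 (e, f)) -
       R 3 f * ∑ e, (S (0, 1) e * P 2 (e, f) - S (0, 2) e * P 1 (e, f) +
        S (1, 2) e * P 0 (e, f))) := by
  rw [fresnelContr_eq, sum_eps_mul_of_antisymm]
  · simp only [Fin.sum_univ_four]
    ring
  · intro a b c d
    simp only [hS a b, neg_mul, Finset.sum_neg_distrib]

set_option maxHeartbeats 4000000 in
theorem fresnel_minkMedium (p ρ C : ℝ) (A : BV) (hA : antisymBV A) (ξ : Fin 4 → ℝ) :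
    fresnel (minkMedium p ρ C A) ξ = - p ^ 2 * (∑ i, minkDiag i * ξ i * ξ i) *
      (p * (∑ i, minkDiag i * ξ i * ξ i) +
        2 * ρ * ∑ i, minkDiag i * (∑ k, A i k * ξ k) * (∑ k, A i k * ξ k)) := by
  have h0 : ∀ i, A i i = 0 := fun i => by linarith [hA i i]
  have hA' : A = !![0, A 0 1, A 0 2, A 0 3; -A 0 1, 0, A 1 2, A 1 3;
      -A 0 2, -A 1 2, 0, A 2 3; -A 0 3, -A 1 3, -A 2 3, 0] := by
    ext i j
    fin_cases i <;> fin_cases j <;> simp [h0, hA 1 0, hA 2 0, hA 3 0, hA 2 1, hA 3 1, hA 3 2]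
  have hξ' : ξ = ![ξ 0, ξ 1, ξ 2, ξ 3] := by
    ext i
    fin_cases i <;> rfl
  generalize A 0 1 = a at hA'
  generalize A 0 2 = b at hA'
  generalize A 0 3 = c at hA'
  generalize A 1 2 = d at hA'
  generalize A 1 3 = e at hA'
  generalize A 2 3 = f at hA'
  generalize ξ 0 = x at hξ'
  generalize ξ 1 = y at hξ'
  generalize ξ 2 = z at hξ'
  generalize ξ 3 = w at hξ'
  have hv : (fun i => ∑ k, A i k * ξ k) = ![a * y + b * z + c * w, -a * x + d * z + e * w,
      -b * x - d * y + f * w, -c * x - e * y - f * z] := by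
    subst hA' hξ'
    ext i
    fin_cases i <;> simp [Fin.sum_univ_four] <;> ring
  have hv' : ∀ i, ∑ k, A i k * ξ k = ![a * y + b * z + c * w, -a * x + d * z + e * w,
      -b * x - d * y + f * w, -c * x - e * y - f * z] i := congrFun hv
  have hT : ∀ r s, ∑ i, ∑ j, eps r s i j * A i j = !![0, 2 * f, -2 * e, 2 * d;
      -2 * f, 0, 2 * c, -2 * b; 2 * e, -2 * c, 0, 2 * a; -2 * d, 2 * b, -2 * a, 0] r s := by
    subst hA'
    intro r s
    fin_cases r <;> fin_cases s <;> simp [Fin.sum_univ_four, eps] <;> ring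
  rw [fresnel_eq, fresnelContr_eq_of_antisymm]
  · have hS01 : ∀ i, (pairMat (minkMedium p ρ C A) * epsCov ξ) (0, 1) i =
        ![4 * ρ * a * (a * y + b * z + c * w) - 2 * p * y,
          4 * ρ * a * (-a * x + d * z + e * w) + 2 * p * x,
          4 * ρ * a * (-b * x - d * y + f * w) + 2 * C * w,
          4 * ρ * a * (-c * x - e * y - f * z) - 2 * C * z] i := by
      intro i
      rw [minkMedium_mul_epsCov p ρ C A hA, hv']
      subst hA' hξ'
      fin_cases i <;>
        simp [Fin.sum_univ_four, eps, minkDiag, -mul_eq_mul_left_iff, -mul_eq_mul_right_iff] <;>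
        ring
    have hS02 : ∀ i, (pairMat (minkMedium p ρ C A) * epsCov ξ) (0, 2) i =
        ![4 * ρ * b * (a * y + b * z + c * w) - 2 * p * z,
          4 * ρ * b * (-a * x + d * z + e * w) - 2 * C * w,
          4 * ρ * b * (-b * x - d * y + f * w) + 2 * p * x,
          4 * ρ * b * (-c * x - e * y - f * z) + 2 * C * y] i := by
      intro i
      rw [minkMedium_mul_epsCov p ρ C A hA, hv']
      subst hA' hξ'
      fin_cases i <;>
        simp [Fin.sum_univ_four, eps, minkDiag, -mul_eq_mul_left_iff, -mul_eq_mul_right_iff] <;>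
        ring
    have hS03 : ∀ i, (pairMat (minkMedium p ρ C A) * epsCov ξ) (0, 3) i =
        ![4 * ρ * c * (a * y + b * z + c * w) - 2 * p * w,
          4 * ρ * c * (-a * x + d * z + e * w) + 2 * C * z,
          4 * ρ * c * (-b * x - d * y + f * w) - 2 * C * y,
          4 * ρ * c * (-c * x - e * y - f * z) + 2 * p * x] i := by
      intro i
      rw [minkMedium_mul_epsCov p ρ C A hA, hv']
      subst hA' hξ'
      fin_cases i <;>
        simp [Fin.sum_univ_four, eps, minkDiag, -mul_eq_mul_left_iff, -mul_eq_mul_right_iff] <;>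
        ring
    have hS12 : ∀ i, (pairMat (minkMedium p ρ C A) * epsCov ξ) (1, 2) i =
        ![4 * ρ * d * (a * y + b * z + c * w) + 2 * C * w,
          4 * ρ * d * (-a * x + d * z + e * w) + 2 * p * z,
          4 * ρ * d * (-b * x - d * y + f * w) - 2 * p * y,
          4 * ρ * d * (-c * x - e * y - f * z) - 2 * C * x] i := by
      intro i
      rw [minkMedium_mul_epsCov p ρ C A hA, hv']
      subst hA' hξ'
      fin_cases i <;>
        simp [Fin.sum_univ_four, eps, minkDiag, -mul_eq_mul_left_iff, -mul_eq_mul_right_iff] <;>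
        ring
    have hS13 : ∀ i, (pairMat (minkMedium p ρ C A) * epsCov ξ) (1, 3) i =
        ![4 * ρ * e * (a * y + b * z + c * w) - 2 * C * z,
          4 * ρ * e * (-a * x + d * z + e * w) + 2 * p * w,
          4 * ρ * e * (-b * x - d * y + f * w) + 2 * C * x,
          4 * ρ * e * (-c * x - e * y - f * z) - 2 * p * y] i := by
      intro i
      rw [minkMedium_mul_epsCov p ρ C A hA, hv']
      subst hA' hξ'
      fin_cases i <;>
        simp [Fin.sum_univ_four, eps, minkDiag, -mul_eq_mul_left_iff, -mul_eq_mul_right_iff] <;>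
        ring
    have hS23 : ∀ i, (pairMat (minkMedium p ρ C A) * epsCov ξ) (2, 3) i =
        ![4 * ρ * f * (a * y + b * z + c * w) + 2 * C * y,
          4 * ρ * f * (-a * x + d * z + e * w) - 2 * C * x,
          4 * ρ * f * (-b * x - d * y + f * w) + 2 * p * w,
          4 * ρ * f * (-c * x - e * y - f * z) - 2 * p * z] i := by
      intro i
      rw [minkMedium_mul_epsCov p ρ C A hA, hv']
      subst hA' hξ'
      fin_cases i <;>
        simp [Fin.sum_univ_four, eps, minkDiag, -mul_eq_mul_left_iff, -mul_eq_mul_right_iff] <;>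
        ring
    have hP0 : ∀ i j, (sndCov ξ * pairMat (minkMedium p ρ C A)) 0 (i, j) =
        !![0,
          ρ * (2 * f) * (a * y + b * z + c * w) + C * y,
          ρ * (-2 * e) * (a * y + b * z + c * w) + C * z,
          ρ * (2 * d) * (a * y + b * z + c * w) + C * w;
          ρ * (-(2 * f)) * (a * y + b * z + c * w) - C * y,
          0,
          ρ * (2 * c) * (a * y + b * z + c * w) - p * w,
          ρ * (-2 * b) * (a * y + b * z + c * w) + p * z;
          ρ * (-(-2 * e)) * (a * y + b * z + c * w) - C * z,
          ρ * (-(2 * c)) * (a * y + b * z + c * w) + p * w,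
          0,
          ρ * (2 * a) * (a * y + b * z + c * w) - p * y;
          ρ * (-(2 * d)) * (a * y + b * z + c * w) - C * w,
          ρ * (-(-2 * b)) * (a * y + b * z + c * w) - p * z,
          ρ * (-(2 * a)) * (a * y + b * z + c * w) + p * y,
          0] i j := by
      intro i j
      rw [sndCov_mul_minkMedium, hv', hT]
      subst hA' hξ'
      fin_cases i <;> fin_cases j <;>
        simp [Fin.sum_univ_four, eps, minkDiag, -mul_eq_mul_left_iff, -mul_eq_mul_right_iff] <;>
        ring
    have hP1 : ∀ i j, (sndCov ξ * pairMat (minkMedium p ρ C A)) 1 (i, j) =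
        !![0,
          ρ * (2 * f) * (-a * x + d * z + e * w) - C * x,
          ρ * (-2 * e) * (-a * x + d * z + e * w) - p * w,
          ρ * (2 * d) * (-a * x + d * z + e * w) + p * z;
          ρ * (-(2 * f)) * (-a * x + d * z + e * w) + C * x,
          0,
          ρ * (2 * c) * (-a * x + d * z + e * w) + C * z,
          ρ * (-2 * b) * (-a * x + d * z + e * w) + C * w;
          ρ * (-(-2 * e)) * (-a * x + d * z + e * w) + p * w,
          ρ * (-(2 * c)) * (-a * x + d * z + e * w) - C * z,
          0,
          ρ * (2 * a) * (-a * x + d * z + e * w) + p * x;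
          ρ * (-(2 * d)) * (-a * x + d * z + e * w) - p * z,
          ρ * (-(-2 * b)) * (-a * x + d * z + e * w) - C * w,
          ρ * (-(2 * a)) * (-a * x + d * z + e * w) - p * x,
          0] i j := by
      intro i j
      rw [sndCov_mul_minkMedium, hv', hT]
      subst hA' hξ'
      fin_cases i <;> fin_cases j <;>
        simp [Fin.sum_univ_four, eps, minkDiag, -mul_eq_mul_left_iff, -mul_eq_mul_right_iff] <;>
        ring
    have hP2 : ∀ i j, (sndCov ξ * pairMat (minkMedium p ρ C A)) 2 (i, j) =
        !![0,
          ρ * (2 * f) * (-b * x - d * y + f * w) + p * w,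
          ρ * (-2 * e) * (-b * x - d * y + f * w) - C * x,
          ρ * (2 * d) * (-b * x - d * y + f * w) - p * y;
          ρ * (-(2 * f)) * (-b * x - d * y + f * w) - p * w,
          0,
          ρ * (2 * c) * (-b * x - d * y + f * w) - C * y,
          ρ * (-2 * b) * (-b * x - d * y + f * w) - p * x;
          ρ * (-(-2 * e)) * (-b * x - d * y + f * w) + C * x,
          ρ * (-(2 * c)) * (-b * x - d * y + f * w) + C * y,
          0,
          ρ * (2 * a) * (-b * x - d * y + f * w) + C * w;
          ρ * (-(2 * d)) * (-b * x - d * y + f * w) + p * y,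
          ρ * (-(-2 * b)) * (-b * x - d * y + f * w) + p * x,
          ρ * (-(2 * a)) * (-b * x - d * y + f * w) - C * w,
          0] i j := by
      intro i j
      rw [sndCov_mul_minkMedium, hv', hT]
      subst hA' hξ'
      fin_cases i <;> fin_cases j <;>
        simp [Fin.sum_univ_four, eps, minkDiag, -mul_eq_mul_left_iff, -mul_eq_mul_right_iff] <;>
        ring
    have hP3 : ∀ i j, (sndCov ξ * pairMat (minkMedium p ρ C A)) 3 (i, j) =
        !![0,
          ρ * (2 * f) * (-c * x - e * y - f * z) - p * z,
          ρ * (-2 * e) * (-c * x - e * y - f * z) + p * y,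
          ρ * (2 * d) * (-c * x - e * y - f * z) - C * x;
          ρ * (-(2 * f)) * (-c * x - e * y - f * z) + p * z,
          0,
          ρ * (2 * c) * (-c * x - e * y - f * z) + p * x,
          ρ * (-2 * b) * (-c * x - e * y - f * z) - C * y;
          ρ * (-(-2 * e)) * (-c * x - e * y - f * z) - p * y,
          ρ * (-(2 * c)) * (-c * x - e * y - f * z) - p * x,
          0,
          ρ * (2 * a) * (-c * x - e * y - f * z) - C * z;
          ρ * (-(2 * d)) * (-c * x - e * y - f * z) + C * x,
          ρ * (-(-2 * b)) * (-c * x - e * y - f * z) + C * y,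
          ρ * (-(2 * a)) * (-c * x - e * y - f * z) + C * z,
          0] i j := by
      intro i j
      rw [sndCov_mul_minkMedium, hv', hT]
      subst hA' hξ'
      fin_cases i <;> fin_cases j <;>
        simp [Fin.sum_univ_four, eps, minkDiag, -mul_eq_mul_left_iff, -mul_eq_mul_right_iff] <;>
        ring
    have hR : ∀ i j, (sndCov ξ * (pairMat (minkMedium p ρ C A) * epsCov ξ)) i j =
        !![4 * ρ * (a * y + b * z + c * w) * (a * y + b * z + c * w) - 2 * p * x * x + 2 * p * (-1) * (-x * x + y * y + z * z + w * w),
          4 * ρ * (a * y + b * z + c * w) * (-a * x + d * z + e * w) - 2 * p * (-1) * x * y,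
          4 * ρ * (a * y + b * z + c * w) * (-b * x - d * y + f * w) - 2 * p * (-1) * x * z,
          4 * ρ * (a * y + b * z + c * w) * (-c * x - e * y - f * z) - 2 * p * (-1) * x * w;
          4 * ρ * (-a * x + d * z + e * w) * (a * y + b * z + c * w) - 2 * p * (-1) * y * x,
          4 * ρ * (-a * x + d * z + e * w) * (-a * x + d * z + e * w) - 2 * p * y * y + 2 * p * (-x * x + y * y + z * z + w * w),
          4 * ρ * (-a * x + d * z + e * w) * (-b * x - d * y + f * w) - 2 * p * y * z,
          4 * ρ * (-a * x + d * z + e * w) * (-c * x - e * y - f * z) - 2 * p * y * w;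
          4 * ρ * (-b * x - d * y + f * w) * (a * y + b * z + c * w) - 2 * p * (-1) * z * x,
          4 * ρ * (-b * x - d * y + f * w) * (-a * x + d * z + e * w) - 2 * p * z * y,
          4 * ρ * (-b * x - d * y + f * w) * (-b * x - d * y + f * w) - 2 * p * z * z + 2 * p * (-x * x + y * y + z * z + w * w),
          4 * ρ * (-b * x - d * y + f * w) * (-c * x - e * y - f * z) - 2 * p * z * w;
          4 * ρ * (-c * x - e * y - f * z) * (a * y + b * z + c * w) - 2 * p * (-1) * w * x,
          4 * ρ * (-c * x - e * y - f * z) * (-a * x + d * z + e * w) - 2 * p * w * y,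
          4 * ρ * (-c * x - e * y - f * z) * (-b * x - d * y + f * w) - 2 * p * w * z,
          4 * ρ * (-c * x - e * y - f * z) * (-c * x - e * y - f * z) - 2 * p * w * w + 2 * p * (-x * x + y * y + z * z + w * w)] i j := by
      intro i j
      rw [sndCov_mul_minkMedium_mul_epsCov p ρ C A hA, hv', hv']
      subst hA' hξ'
      fin_cases i <;> fin_cases j <;>
        simp [Fin.sum_univ_four, minkDiag, -mul_eq_mul_left_iff, -mul_eq_mul_right_iff] <;> ring
    have hQ : ∑ i, minkDiag i * ξ i * ξ i = -x * x + y * y + z * z + w * w := by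
      subst hξ'
      simp [Fin.sum_univ_four, minkDiag]
    rw [hQ]
    simp only [hS01, hS02, hS03, hS12, hS13, hS23, hP0, hP1, hP2, hP3, hR, hv', Fin.sum_univ_four, minkDiag, Matrix.of_apply, Matrix.cons_val]
    clear hv hv' hT h0 hA hQ hR hS01 hS02 hS03 hS12 hS13 hS23 hP0 hP1 hP2 hP3
    clear hA' hξ'
    ring
  · intro a b c
    simp only [minkMedium_mul_epsCov p ρ C A hA, hA b a, eps_swap_left a b,
      neg_mul, Finset.sum_neg_distrib]
    ring

/-- The Levi-Civita symbol as a matrix on index pairs. -/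
def epsPair : Matrix (Fin 4 × Fin 4) (Fin 4 × Fin 4) ℝ :=
  fun p q => eps p.1 p.2 q.1 q.2

/-- A bivector as a vector on index pairs. -/
def pairVec (A : BV) : Fin 4 × Fin 4 → ℝ := fun p => A p.1 p.2

theorem kron_transpose_mul_epsPair_mul_kron (N : Matrix (Fin 4) (Fin 4) ℝ) :
    (N ⊗ₖ N)ᵀ * epsPair * (N ⊗ₖ N) = N.det • epsPair := by
  ext ⟨i, j⟩ ⟨k, l⟩
  simp only [Matrix.mul_apply, Matrix.kroneckerMap_apply, Fintype.sum_prod_type, epsPair,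
    Matrix.smul_apply, smul_eq_mul, Matrix.transpose_apply]
  rw [← Matrix.det_transpose, ← sum_eps_mul]
  simp only [Finset.sum_mul, Matrix.transpose_apply]
  calc _ = ∑ c, ∑ d, ∑ a, ∑ b, eps a b c d * N a i * N b j * N c k * N d l := by
        refine Finset.sum_congr rfl fun c _ => Finset.sum_congr rfl fun d _ =>
          Finset.sum_congr rfl fun a _ => Finset.sum_congr rfl fun b _ => ?_
        ring
    _ = _ :=
        sum_sum_comm_pairs fun c d a b => eps a b c d * N a i * N b j * N c k * N d l

theorem epsPair_mul_kron (M N : Matrix (Fin 4) (Fin 4) ℝ) (hMN : M * N = 1) :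
    epsPair * (N ⊗ₖ N) = N.det • ((M ⊗ₖ M)ᵀ * epsPair) := by
  have h1 : (M ⊗ₖ M)ᵀ * (N ⊗ₖ N)ᵀ = 1 := by
    rw [← Matrix.transpose_mul, ← Matrix.mul_kronecker_mul, mul_eq_one_comm.1 hMN,
      Matrix.one_kronecker_one, Matrix.transpose_one]
  rw [← Matrix.mul_smul, ← kron_transpose_mul_epsPair_mul_kron, Matrix.mul_assoc,
    ← Matrix.mul_assoc, h1, Matrix.one_mul]

theorem pairMat_idT_mul_kron (N : Matrix (Fin 4) (Fin 4) ℝ) :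
    pairMat idT * (N ⊗ₖ N) = (N ⊗ₖ N) * pairMat idT := by
  ext ⟨i, j⟩ ⟨r, s⟩
  simp only [Matrix.mul_apply, Matrix.kroneckerMap_apply, Fintype.sum_prod_type, pairMat]
  rw [sum_idT_mul i j fun c d => N c r * N d s, sum_mul_idT r s fun c d => N i c * N j d]
  ring

theorem pairMat_tensAB (ρ : ℝ) (A : BV) :
    pairMat (tensAB ρ A A) = ρ • Matrix.vecMulVec (pairVec A) (epsPair *ᵥ pairVec A) := by
  ext ⟨i, j⟩ ⟨r, s⟩
  simp only [pairMat, tensAB, Matrix.smul_apply, Matrix.vecMulVec_apply, pairVec, Matrix.mulVec,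
    dotProduct, epsPair, Fintype.sum_prod_type, smul_eq_mul]
  ring

theorem pairMat_minkMedium (p ρ C : ℝ) (A : BV) :
    pairMat (minkMedium p ρ C A) =
      p • ((Matrix.diagonal minkDiag ⊗ₖ Matrix.diagonal minkDiag) * epsPair) +
        pairMat (tensAB ρ A A) + C • pairMat idT := by
  ext ⟨i, j⟩ ⟨r, s⟩
  rw [Matrix.diagonal_kronecker_diagonal]
  simp [pairMat, minkMedium, epsPair, Matrix.diagonal_mul]

theorem pairMat_hodge (g : Matrix (Fin 4) (Fin 4) ℝ) :
    pairMat (hodge g) = Real.sqrt |g.det| • ((g⁻¹ ⊗ₖ g⁻¹) * epsPair) := by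
  ext ⟨i, j⟩ ⟨r, s⟩
  simp only [pairMat, hodge, epsPair, Matrix.smul_apply, Matrix.mul_apply,
    Matrix.kroneckerMap_apply, Fintype.sum_prod_type, smul_eq_mul]

/-- Components of a bivector in another frame. -/
def frameBV (N : Matrix (Fin 4) (Fin 4) ℝ) (A : BV) : BV :=
  fun i j => ((N ⊗ₖ N) *ᵥ pairVec A) (i, j)

theorem pairVec_frameBV (N : Matrix (Fin 4) (Fin 4) ℝ) (A : BV) :
    pairVec (frameBV N A) = (N ⊗ₖ N) *ᵥ pairVec A := rfl

theorem antisymBV_frameBV (N : Matrix (Fin 4) (Fin 4) ℝ) (A : BV) (hA : antisymBV A) :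
    antisymBV (frameBV N A) := by
  intro i j
  simp only [frameBV, pairVec, Matrix.mulVec, dotProduct, Fintype.sum_prod_type,
    Matrix.kroneckerMap_apply]
  rw [Finset.sum_comm, ← Finset.sum_neg_distrib]
  refine Finset.sum_congr rfl fun a _ => ?_
  rw [← Finset.sum_neg_distrib]
  refine Finset.sum_congr rfl fun b _ => ?_
  rw [hA b a]
  ring

theorem kron_mulVec_pairVec_frameBV (M N : Matrix (Fin 4) (Fin 4) ℝ) (hMN : M * N = 1) (A : BV) :
    (M ⊗ₖ M) *ᵥ pairVec (frameBV N A) = pairVec A := by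
  rw [pairVec_frameBV, Matrix.mulVec_mulVec, ← Matrix.mul_kronecker_mul, hMN,
    Matrix.one_kronecker_one, Matrix.one_mulVec]

theorem eq_zero_of_frameBV_eq_zero (M N : Matrix (Fin 4) (Fin 4) ℝ) (hMN : M * N = 1) (A : BV)
    (h : frameBV N A = 0) : A = 0 := by
  have h1 := kron_mulVec_pairVec_frameBV M N hMN A
  have h2 : pairVec (frameBV N A) = 0 := by rw [h]; rfl
  rw [h2, Matrix.mulVec_zero] at h1
  ext i j
  exact (congrFun h1 (i, j)).symm

/-- A generalized Q-medium takes the Minkowski form in an orthonormal frame. -/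
theorem pairMat_medium_eq (g M N : Matrix (Fin 4) (Fin 4) ℝ) (hMN : M * N = 1) (σ : ℝ)
    (hσ : σ * σ = 1) (hg : g⁻¹ = σ • (M * Matrix.diagonal minkDiag * Mᵀ)) (C₁ C₂ ρ : ℝ) (A : BV) :
    pairMat (fun i j r s => C₁ * hodge g i j r s + tensAB ρ A A i j r s + C₂ * idT i j r s) =
      (M ⊗ₖ M) * pairMat (minkMedium (C₁ * Real.sqrt |g.det| * M.det) (ρ * M.det) C₂
        (frameBV N A)) * (N ⊗ₖ N) := by
  have hdet : M.det * N.det = 1 := by rw [← Matrix.det_mul, hMN, Matrix.det_one]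
  have hMMNN : (M ⊗ₖ M) * (N ⊗ₖ N) = 1 := by
    rw [← Matrix.mul_kronecker_mul, hMN, Matrix.one_kronecker_one]
  have hsplit : pairMat (fun i j r s =>
      C₁ * hodge g i j r s + tensAB ρ A A i j r s + C₂ * idT i j r s) =
      C₁ • pairMat (hodge g) + pairMat (tensAB ρ A A) + C₂ • pairMat idT := rfl
  have hH : (g⁻¹ ⊗ₖ g⁻¹) = (M ⊗ₖ M) * (Matrix.diagonal minkDiag ⊗ₖ Matrix.diagonal minkDiag) *
      (M ⊗ₖ M)ᵀ := by
    rw [hg, Matrix.smul_kronecker, Matrix.kronecker_smul, smul_smul, hσ, one_smul,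
      Matrix.mul_kronecker_mul, Matrix.mul_kronecker_mul, Matrix.kroneckerMap_transpose]
  have hT : (epsPair *ᵥ pairVec (frameBV N A)) ᵥ* (N ⊗ₖ N) =
      N.det • (epsPair *ᵥ pairVec A) := by
    rw [← Matrix.mulVec_transpose, pairVec_frameBV, Matrix.mulVec_mulVec, Matrix.mulVec_mulVec,
      kron_transpose_mul_epsPair_mul_kron, Matrix.smul_mulVec]
  rw [hsplit, pairMat_minkMedium, pairMat_hodge, pairMat_tensAB, pairMat_tensAB, hH]
  simp only [Matrix.mul_add, Matrix.add_mul, Matrix.mul_smul, Matrix.smul_mul]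
  congr 1
  · congr 1
    · rw [← Matrix.mul_assoc (M ⊗ₖ M), Matrix.mul_assoc _ epsPair, epsPair_mul_kron M N hMN,
        Matrix.mul_smul, smul_smul, smul_smul, Matrix.mul_assoc _ _ epsPair]
      congr 1
      linear_combination - (C₁ * Real.sqrt |g.det|) * hdet
    · rw [Matrix.mul_vecMulVec, Matrix.vecMulVec_mul, kron_mulVec_pairVec_frameBV M N hMN, hT,
        Matrix.vecMulVec_smul, smul_smul]
      congr 1
      linear_combination - ρ * hdet
  · rw [Matrix.mul_assoc, pairMat_idT_mul_kron, ← Matrix.mul_assoc, hMMNN, Matrix.one_mul]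

theorem eq_smul_diagonal_minkDiag (K : Matrix (Fin 4) (Fin 4) ℝ) (hK : K.IsSymm)
    (h : ∀ ζ : Fin 4 → ℝ, ζ ⬝ᵥ (Matrix.diagonal minkDiag *ᵥ ζ) = 0 → ζ ⬝ᵥ (K *ᵥ ζ) = 0) :
    K = K 1 1 • Matrix.diagonal minkDiag := by
  have e10 := hK.apply 0 1
  have e20 := hK.apply 0 2
  have e30 := hK.apply 0 3
  have e21 := hK.apply 1 2
  have e31 := hK.apply 1 3
  have e32 := hK.apply 2 3
  have h' : ∀ t x y z : ℝ, -t * t + x * x + y * y + z * z = 0 →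
      K 0 0 * t * t + K 1 1 * x * x + K 2 2 * y * y + K 3 3 * z * z +
      2 * (K 0 1 * t * x + K 0 2 * t * y + K 0 3 * t * z + K 1 2 * x * y + K 1 3 * x * z +
        K 2 3 * y * z) = 0 := by
    intro t x y z hq
    have := h ![t, x, y, z] (by
      simp [Matrix.mulVec_diagonal, dotProduct, Fin.sum_univ_four, minkDiag]; linarith)
    simp [Matrix.mulVec, dotProduct, Fin.sum_univ_four, e10, e20, e30, e21, e31, e32] at this
    linarith
  have h1 := h' 1 1 0 0 (by norm_num)
  have h2 := h' 1 (-1) 0 0 (by norm_num)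
  have h3 := h' 1 0 1 0 (by norm_num)
  have h4 := h' 1 0 (-1) 0 (by norm_num)
  have h5 := h' 1 0 0 1 (by norm_num)
  have h6 := h' 1 0 0 (-1) (by norm_num)
  have h7 := h' 5 3 4 0 (by norm_num)
  have h8 := h' 5 3 0 4 (by norm_num)
  have h9 := h' 5 0 3 4 (by norm_num)
  ext i j
  fin_cases i <;> fin_cases j <;> simp [minkDiag] <;> linarith

theorem exists_odd_sign_of_prod_neg (l : Fin 4 → ℝ) (hl : ∏ i, l i < 0) :
    ∃ (k : Fin 4) (σ : ℝ), σ * σ = 1 ∧ ∀ i, l i = σ * (|l i| * if i = k then -1 else 1) := by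
  have hcomb : ∀ s : Fin 4 → SignType, s 0 * s 1 * s 2 * s 3 = -1 →
      ∃ (k : Fin 4) (σ : SignType), σ * σ = 1 ∧ ∀ i, s i = σ * if i = k then -1 else 1 := by
    decide +kernel
  have hprod := sign_neg hl
  simp only [Fin.prod_univ_four, sign_mul] at hprod
  obtain ⟨k, σ, hσ, h⟩ := hcomb (fun i => SignType.sign (l i)) hprod
  refine ⟨k, σ, by exact_mod_cast congrArg (SignType.cast : SignType → ℝ) hσ, fun i => ?_⟩
  nth_rw 1 [← sign_mul_abs (l i), h i]
  push_cast
  split_ifs <;> simp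

theorem mul_diagonal_mul_transpose_apply (U : Matrix (Fin 4) (Fin 4) ℝ) (d : Fin 4 → ℝ)
    (i j : Fin 4) : (U * Matrix.diagonal d * Uᵀ) i j = ∑ y, U i y * d y * U j y := by
  rw [Matrix.mul_apply]
  simp only [Matrix.mul_diagonal, Matrix.transpose_apply]

/-- Sylvester normal form of a Lorentzian quadratic form. -/
theorem exists_frame (H : Matrix (Fin 4) (Fin 4) ℝ) (hH : H.IsSymm) (hdet : H.det < 0) :
    ∃ (M N : Matrix (Fin 4) (Fin 4) ℝ) (σ : ℝ), M * N = 1 ∧ σ * σ = 1 ∧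
      H = σ • (M * Matrix.diagonal minkDiag * Mᵀ) := by
  have hHerm : H.IsHermitian := by
    rw [Matrix.IsHermitian, Matrix.conjTranspose_eq_transpose_of_trivial]
    exact hH
  obtain ⟨U, l, hUl, hl⟩ : ∃ (U : Matrix (Fin 4) (Fin 4) ℝ) (l : Fin 4 → ℝ),
      H = U * Matrix.diagonal l * Uᵀ ∧ H.det = ∏ i, l i := by
    refine ⟨hHerm.eigenvectorUnitary, hHerm.eigenvalues, ?_, by
      simpa using hHerm.det_eq_prod_eigenvalues⟩
    conv_lhs => rw [hHerm.spectral_theorem]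
    rw [Unitary.conjStarAlgAut_apply, Matrix.star_eq_conjTranspose,
      Matrix.conjTranspose_eq_transpose_of_trivial]
    rfl
  obtain ⟨k, σ, hσ, h⟩ := exists_odd_sign_of_prod_neg l (hl ▸ hdet)
  obtain ⟨M, hM⟩ : ∃ M : Matrix (Fin 4) (Fin 4) ℝ,
      M = (U * Matrix.diagonal fun i => Real.sqrt |l i|).submatrix id (Equiv.swap 0 k) := ⟨_, rfl⟩
  have hHM : H = σ • (M * Matrix.diagonal minkDiag * Mᵀ) := by
    have hD : ∀ y, minkDiag (Equiv.swap 0 k y) = if y = k then -1 else 1 := by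
      have h0 : ∀ z, minkDiag z = if z = 0 then -1 else 1 := by
        intro z
        fin_cases z <;> simp [minkDiag]
      intro y
      simp only [h0, Equiv.swap_apply_eq_iff, Equiv.swap_apply_left]
    have hMe : ∀ i y, M i (Equiv.swap 0 k y) = U i y * Real.sqrt |l y| := fun i y => by
      simp [hM, Matrix.mul_diagonal]
    ext i j
    calc H i j = ∑ y, U i y * l y * U j y := by
          rw [hUl, mul_diagonal_mul_transpose_apply]
      _ = ∑ y, σ * (M i (Equiv.swap 0 k y) * minkDiag (Equiv.swap 0 k y) *
          M j (Equiv.swap 0 k y)) := by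
          refine Finset.sum_congr rfl fun y _ => ?_
          rw [hMe, hMe, hD]
          linear_combination U i y * U j y * (h y) -
            U i y * U j y * (σ * if y = k then -1 else 1) * Real.mul_self_sqrt (abs_nonneg (l y))
      _ = ∑ x, σ * (M i x * minkDiag x * M j x) :=
          Equiv.sum_comp (Equiv.swap 0 k) fun x => σ * (M i x * minkDiag x * M j x)
      _ = _ := by
          rw [← Finset.mul_sum, Matrix.smul_apply, mul_diagonal_mul_transpose_apply, smul_eq_mul]
  have hMdet : IsUnit M.det := by
    rw [isUnit_iff_ne_zero]
    intro h0
    rw [hHM, Matrix.det_smul, Matrix.det_mul, Matrix.det_mul, h0] at hdet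
    simp at hdet
  exact ⟨M, M⁻¹, σ, Matrix.mul_nonsing_inv M hMdet, hσ, hHM⟩

theorem dotProduct_mulVec_congr (K M : Matrix (Fin 4) (Fin 4) ℝ) (ξ : Fin 4 → ℝ) :
    ξ ⬝ᵥ ((M * K * Mᵀ) *ᵥ ξ) = (Mᵀ *ᵥ ξ) ⬝ᵥ (K *ᵥ (Mᵀ *ᵥ ξ)) := by
  rw [← Matrix.mulVec_mulVec, ← Matrix.mulVec_mulVec, Matrix.dotProduct_mulVec,
    Matrix.mulVec_transpose]

/-- A quadratic form vanishing on the null cone of a Lorentzian form is a multiple of it. -/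
theorem exists_eq_smul_of_null_subset (H K : Matrix (Fin 4) (Fin 4) ℝ) (hH : H.IsSymm)
    (hdet : H.det < 0) (hK : K.IsSymm)
    (h : ∀ ξ : Fin 4 → ℝ, ξ ⬝ᵥ (H *ᵥ ξ) = 0 → ξ ⬝ᵥ (K *ᵥ ξ) = 0) : ∃ c : ℝ, K = c • H := by
  obtain ⟨M, N, σ, hMN, hσ, rfl⟩ := exists_frame H hH hdet
  have hNM : N * M = 1 := mul_eq_one_comm.1 hMN
  have hMN' : Mᵀ * Nᵀ = 1 := by rw [← Matrix.transpose_mul, hNM, Matrix.transpose_one]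
  have hNM' : Nᵀ * Mᵀ = 1 := by rw [← Matrix.transpose_mul, hMN, Matrix.transpose_one]
  have hK' : (N * K * Nᵀ).IsSymm := by
    rw [Matrix.IsSymm, Matrix.transpose_mul, Matrix.transpose_mul, Matrix.transpose_transpose,
      hK.eq, Matrix.mul_assoc]
  have key := eq_smul_diagonal_minkDiag _ hK' fun ζ hζ => by
    rw [dotProduct_mulVec_congr]
    apply h
    rw [Matrix.smul_mulVec, dotProduct_smul, dotProduct_mulVec_congr, Matrix.mulVec_mulVec,
      hMN', Matrix.one_mulVec, hζ, smul_zero]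
  generalize (N * K * Nᵀ) 1 1 = c at key
  refine ⟨c * σ, ?_⟩
  calc K = (M * N) * K * (Nᵀ * Mᵀ) := by rw [hMN, hNM', Matrix.one_mul, Matrix.mul_one]
    _ = M * (N * K * Nᵀ) * Mᵀ := by simp only [Matrix.mul_assoc]
    _ = _ := by rw [key, smul_smul, mul_assoc c, hσ, mul_one, Matrix.mul_smul, Matrix.smul_mul]

set_option maxRecDepth 4000 in
theorem exists_nonnull_zero_of_degenerate (q : ℝ) (hq : q ≠ 0) (a b c d e f : ℝ)
    (hΔ : q ^ 2 - q * (a ^ 2 + b ^ 2 + c ^ 2 - d ^ 2 - e ^ 2 - f ^ 2) -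
      (a * f - b * e + c * d) ^ 2 = 0) :
    ∃ x y z w : ℝ, -x * x + y * y + z * z + w * w ≠ 0 ∧
      q * (-x * x + y * y + z * z + w * w) - (a * y + b * z + c * w) ^ 2 +
        (-a * x + d * z + e * w) ^ 2 + (-b * x - d * y + f * w) ^ 2 +
        (-c * x - e * y - f * z) ^ 2 = 0 := by
  by_cases hu : q = a ^ 2 + b ^ 2 + c ^ 2
  · exact ⟨1, 0, 0, 0, by norm_num, by rw [hu]; ring⟩
  by_cases hS : (b * d + c * e) ^ 2 + (c * f - a * d) ^ 2 + (a * e + b * f) ^ 2 = 0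
  · have := sq_nonneg (c * f - a * d)
    have := sq_nonneg (a * e + b * f)
    have := sq_nonneg (b * d + c * e)
    have h1 : b * d + c * e = 0 := (pow_eq_zero_iff two_ne_zero).1 (by linarith)
    have h2 : c * f - a * d = 0 := (pow_eq_zero_iff two_ne_zero).1 (by linarith)
    have h3 : a * e + b * f = 0 := (pow_eq_zero_iff two_ne_zero).1 (by linarith)
    have hv : q = -(d ^ 2 + e ^ 2 + f ^ 2) := by
      have : (q - (a ^ 2 + b ^ 2 + c ^ 2)) * (q + (d ^ 2 + e ^ 2 + f ^ 2)) = 0 := by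
        linear_combination hΔ - hS
      rcases mul_eq_zero.1 this with h | h
      · exact absurd (by linarith) hu
      · linarith
    by_cases hef : e ^ 2 + f ^ 2 = 0
    · have he : e = 0 := by nlinarith [sq_nonneg e, sq_nonneg f]
      have hf : f = 0 := by nlinarith [sq_nonneg e, sq_nonneg f]
      subst he hf
      have hd : d ≠ 0 := by
        rintro rfl
        exact hq (by linarith)
      refine ⟨0, 0, 1, 0, by norm_num, ?_⟩
      have hb : b = 0 := by simpa [hd] using h1
      rw [hv, hb]
      ring
    · refine ⟨0, -e, -f, 0, fun h => hef (by linarith), ?_⟩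
      linear_combination (e ^ 2 + f ^ 2) * hv - (a * e + b * f) * h3
  · obtain ⟨S, hS'⟩ : ∃ S, S = (b * d + c * e) ^ 2 + (c * f - a * d) ^ 2 + (a * e + b * f) ^ 2 :=
      ⟨_, rfl⟩
    obtain ⟨r, hr⟩ : ∃ r, r = a ^ 2 + b ^ 2 + c ^ 2 - q := ⟨_, rfl⟩
    refine ⟨-S, r * (b * d + c * e), r * (c * f - a * d), - r * (a * e + b * f), ?_, ?_⟩
    · intro h
      rw [← hS'] at hS
      have hr0 : r ≠ 0 := fun h0 => hu (by linarith)
      have hSr : S = r ^ 2 := by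
        have : S * (S - r ^ 2) = 0 := by linear_combination -h - r ^ 2 * hS'
        rcases mul_eq_zero.1 this with h0 | h0
        · exact absurd h0 hS
        · linarith
      have hm : r * (d ^ 2 + e ^ 2 + f ^ 2 - (a ^ 2 + b ^ 2 + c ^ 2) + 2 * q) = 0 := by
        rw [hr] at hSr ⊢
        linear_combination hSr - hS' - hΔ
      have hv : d ^ 2 + e ^ 2 + f ^ 2 - (a ^ 2 + b ^ 2 + c ^ 2) + 2 * q = 0 :=
        (mul_eq_zero.1 hm).resolve_left hr0
      have hneg : q ^ 2 + (a * f - b * e + c * d) ^ 2 = 0 := by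
        linear_combination q * hv - hΔ
      exact hq (by nlinarith [sq_nonneg q, sq_nonneg (a * f - b * e + c * d)])
    · rw [hr, hS']
      linear_combination -(a ^ 2 + b ^ 2 + c ^ 2 - q) *
        ((b * d + c * e) ^ 2 + (c * f - a * d) ^ 2 + (a * e + b * f) ^ 2) * hΔ

set_option maxHeartbeats 800000 in
theorem det_factor_form (q a b c d e f : ℝ) :
    !![-q + a ^ 2 + b ^ 2 + c ^ 2, b * d + c * e, c * f - a * d, -a * e - b * f;
      b * d + c * e, q - a ^ 2 + d ^ 2 + e ^ 2, e * f - a * b, -a * c - d * f;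
      c * f - a * d, e * f - a * b, q - b ^ 2 + d ^ 2 + f ^ 2, d * e - b * c;
      -a * e - b * f, -a * c - d * f, d * e - b * c, q - c ^ 2 + e ^ 2 + f ^ 2].det =
    -(q ^ 2 - q * (a ^ 2 + b ^ 2 + c ^ 2 - d ^ 2 - e ^ 2 - f ^ 2) -
      (a * f - b * e + c * d) ^ 2) ^ 2 := by
  simp [Matrix.det_succ_row_zero, Fin.sum_univ_succ, Fin.succAbove]
  ring

/-- In a Minkowski frame, the two factors of the Fresnel polynomial of a generalized Q-medium
cannot cut out a single Lorentzian null cone unless the bivector vanishes. -/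
theorem eq_zero_of_fresnel_factors_null (p ρ : ℝ) (hp : p ≠ 0) (hρ : ρ ≠ 0) (A : BV)
    (hA : antisymBV A) (K : Matrix (Fin 4) (Fin 4) ℝ) (hK : K.IsSymm) (hK0 : K ≠ 0)
    (h : ∀ ζ : Fin 4 → ℝ, (∑ i, minkDiag i * ζ i * ζ i) *
      (p * (∑ i, minkDiag i * ζ i * ζ i) +
        2 * ρ * ∑ i, minkDiag i * (∑ k, A i k * ζ k) * (∑ k, A i k * ζ k)) = 0 ↔
      ζ ⬝ᵥ (K *ᵥ ζ) = 0) : A = 0 := by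
  have hD : ∀ ζ : Fin 4 → ℝ, ζ ⬝ᵥ (Matrix.diagonal minkDiag *ᵥ ζ) =
      ∑ i, minkDiag i * ζ i * ζ i := fun ζ => by
    simp only [Matrix.mulVec_diagonal, dotProduct]
    exact Finset.sum_congr rfl fun _ _ => by ring
  have hKD := eq_smul_diagonal_minkDiag K hK fun ζ hζ => (h ζ).1 (by rw [← hD, hζ, zero_mul])
  generalize K 1 1 = c₀ at hKD
  have hc₀ : c₀ ≠ 0 := by
    rintro rfl
    exact hK0 (by rw [hKD, zero_smul])
  have hnull : ∀ ζ : Fin 4 → ℝ, p * (∑ i, minkDiag i * ζ i * ζ i) +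
        2 * ρ * ∑ i, minkDiag i * (∑ k, A i k * ζ k) * (∑ k, A i k * ζ k) = 0 →
      ∑ i, minkDiag i * ζ i * ζ i = 0 := fun ζ hζ => by
    have h1 := (h ζ).1 (by rw [hζ, mul_zero])
    rw [hKD, Matrix.smul_mulVec, dotProduct_smul, hD, smul_eq_mul] at h1
    exact (mul_eq_zero.1 h1).resolve_left hc₀
  obtain ⟨q, hq⟩ : ∃ q, q = p / (2 * ρ) := ⟨_, rfl⟩
  have hq0 : q ≠ 0 := by rw [hq]; exact div_ne_zero hp (mul_ne_zero two_ne_zero hρ)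
  have hpq : p = 2 * ρ * q := by rw [hq]; field_simp
  have h0 : ∀ i, A i i = 0 := fun i => by linarith [hA i i]
  obtain ⟨a, ha⟩ : ∃ a, a = A 0 1 := ⟨_, rfl⟩
  obtain ⟨b, hb⟩ : ∃ a, a = A 0 2 := ⟨_, rfl⟩
  obtain ⟨c, hc⟩ : ∃ a, a = A 0 3 := ⟨_, rfl⟩
  obtain ⟨d, hd⟩ : ∃ a, a = A 1 2 := ⟨_, rfl⟩
  obtain ⟨e, he⟩ : ∃ a, a = A 1 3 := ⟨_, rfl⟩
  obtain ⟨f, hf⟩ : ∃ a, a = A 2 3 := ⟨_, rfl⟩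
  have hnull' : ∀ x y z w : ℝ, q * (-x * x + y * y + z * z + w * w) -
      (a * y + b * z + c * w) ^ 2 + (-a * x + d * z + e * w) ^ 2 + (-b * x - d * y + f * w) ^ 2 +
        (-c * x - e * y - f * z) ^ 2 = 0 → -x * x + y * y + z * z + w * w = 0 := by
    intro x y z w hxyz
    have := hnull ![x, y, z, w] (by
      simp [Fin.sum_univ_four, minkDiag, h0, hA 1 0, hA 2 0, hA 3 0, hA 2 1, hA 3 1, hA 3 2,
        ← ha, ← hb, ← hc, ← hd, ← he, ← hf, -mul_eq_zero]
      rw [hpq]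
      linear_combination 2 * ρ * hxyz)
    simp [Fin.sum_univ_four, minkDiag] at this
    linarith
  by_cases hΔ : q ^ 2 - q * (a ^ 2 + b ^ 2 + c ^ 2 - d ^ 2 - e ^ 2 - f ^ 2) -
      (a * f - b * e + c * d) ^ 2 = 0
  · obtain ⟨x, y, z, w, hne, hz⟩ := exists_nonnull_zero_of_degenerate q hq0 a b c d e f hΔ
    exact absurd (hnull' x y z w hz) hne
  · obtain ⟨F, hF⟩ : ∃ F : Matrix (Fin 4) (Fin 4) ℝ,
        F = !![-q + a ^ 2 + b ^ 2 + c ^ 2, b * d + c * e, c * f - a * d, -a * e - b * f;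
          b * d + c * e, q - a ^ 2 + d ^ 2 + e ^ 2, e * f - a * b, -a * c - d * f;
          c * f - a * d, e * f - a * b, q - b ^ 2 + d ^ 2 + f ^ 2, d * e - b * c;
          -a * e - b * f, -a * c - d * f, d * e - b * c, q - c ^ 2 + e ^ 2 + f ^ 2] := ⟨_, rfl⟩
    have hFsymm : F.IsSymm := by
      rw [hF]
      ext i j
      fin_cases i <;> fin_cases j <;> rfl
    obtain ⟨m, hm⟩ := exists_eq_smul_of_null_subset F (Matrix.diagonal minkDiag) hFsymm
      (by rw [hF, det_factor_form]; exact neg_neg_of_pos (by positivity)) (Matrix.isSymm_diagonal _)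
      fun ζ hζ => by
        rw [hD]
        have := hnull' (ζ 0) (ζ 1) (ζ 2) (ζ 3) (by
          simp [hF, Matrix.mulVec, dotProduct, Fin.sum_univ_four] at hζ
          linear_combination hζ)
        simp [Fin.sum_univ_four, minkDiag]
        linarith
    have m0 := congrFun (congrFun hm 0) 0
    have m1 := congrFun (congrFun hm 1) 1
    have m2 := congrFun (congrFun hm 2) 2
    have m3 := congrFun (congrFun hm 3) 3
    simp [hF, minkDiag] at m0 m1 m2 m3
    have hm0 : m ≠ 0 := by
      rintro rfl
      simp at m0
    have hsum : a ^ 2 + b ^ 2 + c ^ 2 + d ^ 2 + e ^ 2 + f ^ 2 = 0 := by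
      have : m * (2 * (a ^ 2 + b ^ 2 + c ^ 2 + d ^ 2 + e ^ 2 + f ^ 2)) = 0 := by
        linear_combination -3 * m0 - m1 - m2 - m3
      linarith [(mul_eq_zero.1 this).resolve_left hm0]
    have := sq_nonneg a
    have := sq_nonneg b
    have := sq_nonneg c
    have := sq_nonneg d
    have := sq_nonneg e
    have := sq_nonneg f
    have ha0 : a = 0 := (pow_eq_zero_iff two_ne_zero).1 (by linarith)
    have hb0 : b = 0 := (pow_eq_zero_iff two_ne_zero).1 (by linarith)
    have hc0 : c = 0 := (pow_eq_zero_iff two_ne_zero).1 (by linarith)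
    have hd0 : d = 0 := (pow_eq_zero_iff two_ne_zero).1 (by linarith)
    have he0 : e = 0 := (pow_eq_zero_iff two_ne_zero).1 (by linarith)
    have hf0 : f = 0 := (pow_eq_zero_iff two_ne_zero).1 (by linarith)
    ext i j
    fin_cases i <;> fin_cases j <;> simp [h0, hA 1 0, hA 2 0, hA 3 0, hA 2 1, hA 3 1, hA 3 2,
        ← ha, ← hb, ← hc, ← hd, ← he, ← hf, ha0, hb0, hc0, hd0, he0, hf0]

/-- The generalized Q-medium κ = C₁·∗_g + ρ(Ā⊗A) + C₂·Id is non-birefringent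
(its Fresnel surface is the null cone of some Lorentz metric) if and only if
A = 0 or ρ = 0. -/
theorem stmt11 (g : Matrix (Fin 4) (Fin 4) ℝ) (hg : IsLorentz g)
    (C₁ C₂ ρ : ℝ) (hC₁ : C₁ ≠ 0) (A : BV) (hA : antisymBV A) :
    (∃ h : Matrix (Fin 4) (Fin 4) ℝ, IsLorentz h ∧
        {ξ | fresnel (fun i j r s =>
          C₁ * hodge g i j r s + tensAB ρ A A i j r s + C₂ * idT i j r s) ξ = 0} =
          nullCone h) ↔
      (A = 0 ∨ ρ = 0) := by
  obtain ⟨hgs, hgd⟩ := hg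
  have hinv : ∀ k : Matrix (Fin 4) (Fin 4) ℝ, IsLorentz k → k⁻¹.IsSymm ∧ k⁻¹.det < 0 := by
    rintro k ⟨hk, hkd⟩
    refine ⟨by rw [Matrix.IsSymm, Matrix.transpose_nonsing_inv, hk.eq], ?_⟩
    rw [Matrix.det_nonsing_inv, Ring.inverse_eq_inv']
    exact inv_lt_zero.2 hkd
  have hcone : ∀ (k : Matrix (Fin 4) (Fin 4) ℝ) (ξ : Fin 4 → ℝ),
      ξ ∈ nullCone k ↔ ξ ⬝ᵥ (k⁻¹ *ᵥ ξ) = 0 := by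
    intro k ξ
    simp only [nullCone, Set.mem_ofPred_eq, dotProduct, Matrix.mulVec, Finset.mul_sum]
    simp only [mul_comm, mul_left_comm]
  obtain ⟨M, N, σ, hMN, hσ, hgM⟩ := exists_frame g⁻¹ (hinv g ⟨hgs, hgd⟩).1 (hinv g ⟨hgs, hgd⟩).2
  have hNM : N * M = 1 := mul_eq_one_comm.1 hMN
  have hMN' : Mᵀ * Nᵀ = 1 := by rw [← Matrix.transpose_mul, hNM, Matrix.transpose_one]
  have hdet : M.det * N.det = 1 := by rw [← Matrix.det_mul, hMN, Matrix.det_one]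
  have hM0 : M.det ≠ 0 := left_ne_zero_of_mul_eq_one hdet
  have hN0 : N.det ≠ 0 := right_ne_zero_of_mul_eq_one hdet
  have hσ0 : σ ≠ 0 := left_ne_zero_of_mul_eq_one hσ
  have hfres : ∀ ξ, fresnel (fun i j r s =>
      C₁ * hodge g i j r s + tensAB ρ A A i j r s + C₂ * idT i j r s) ξ = _ := fun ξ =>
    (fresnel_covariant M N hMN _ _ (pairMat_medium_eq g M N hMN σ hσ hgM C₁ C₂ ρ A) ξ).trans
      (congrArg (N.det * ·) (fresnel_minkMedium _ _ _ _ (antisymBV_frameBV N A hA) _))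
  have hp : C₁ * Real.sqrt |g.det| * M.det ≠ 0 :=
    mul_ne_zero (mul_ne_zero hC₁ (Real.sqrt_ne_zero'.2 (abs_pos.2 hgd.ne))) hM0
  have hzero : ∀ ξ, fresnel (fun i j r s =>
      C₁ * hodge g i j r s + tensAB ρ A A i j r s + C₂ * idT i j r s) ξ = 0 ↔ _ := fun ξ => by
    rw [hfres ξ, mul_eq_zero, or_iff_right hN0, mul_assoc, mul_eq_zero,
      or_iff_right (neg_ne_zero.2 (pow_ne_zero 2 hp))]
  generalize C₁ * Real.sqrt |g.det| * M.det = p at hp hzero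
  have hD : ∀ ζ : Fin 4 → ℝ, ζ ⬝ᵥ (Matrix.diagonal minkDiag *ᵥ ζ) =
      ∑ i, minkDiag i * ζ i * ζ i := fun ζ => by
    simp only [Matrix.mulVec_diagonal, dotProduct]
    exact Finset.sum_congr rfl fun _ _ => by ring
  constructor
  · rintro ⟨h, hh, hset⟩
    by_contra! hne
    obtain ⟨hA0, hρ⟩ := hne
    obtain ⟨hKs, hKd⟩ := hinv h hh
    refine hA0 (eq_zero_of_frameBV_eq_zero M N hMN A
      (eq_zero_of_fresnel_factors_null p (ρ * M.det) hp (mul_ne_zero hρ hM0) _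
        (antisymBV_frameBV N A hA) (N * h⁻¹ * Nᵀ) ?_ ?_ fun ζ => ?_))
    · rw [Matrix.IsSymm, Matrix.transpose_mul, Matrix.transpose_mul, Matrix.transpose_transpose,
        hKs.eq, Matrix.mul_assoc]
    · intro h0
      have := congrArg Matrix.det h0
      rw [Matrix.det_mul, Matrix.det_mul, Matrix.det_transpose, Matrix.det_zero] at this
      exact mul_ne_zero (mul_ne_zero hN0 hKd.ne) hN0 this
    · have h1 := hzero (Nᵀ *ᵥ ζ)
      rw [Matrix.mulVec_mulVec, hMN', Matrix.one_mulVec] at h1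
      rw [← h1, dotProduct_mulVec_congr, ← hcone, ← hset, Set.mem_ofPred_eq]
  · intro h
    refine ⟨g, ⟨hgs, hgd⟩, Set.ext fun ξ => ?_⟩
    have hβ : 2 * (ρ * M.det) * ∑ i, minkDiag i * (∑ k, frameBV N A i k * (Mᵀ *ᵥ ξ) k) *
        (∑ k, frameBV N A i k * (Mᵀ *ᵥ ξ) k) = 0 := by
      rcases h with rfl | rfl
      · have : frameBV N 0 = 0 := by
          ext i j
          simp [frameBV, pairVec, Matrix.mulVec, dotProduct]
        simp [this]
      · simp
    rw [Set.mem_ofPred_eq, hzero, hβ, add_zero, hcone, hgM, Matrix.smul_mulVec, dotProduct_smul,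
      dotProduct_mulVec_congr, hD, smul_eq_mul, mul_eq_zero, mul_eq_zero, or_iff_right hp, or_self,
      mul_eq_zero, or_iff_right hσ0]
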